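/- arXiv:2202.05966 — 2 statements merged into one kernel-verified Lean document; each statement's English description precedes it below -/
import Mathlib

section
/- Let u ∈ (−1, 0) and set c = −2(u + u^{-1}). Then the logarithmic zeta function of the two-dimensional F-type Grover walk satisfies ℒ(A^{(f)}, T²_∞, u) = log(1 − u⁴) − (2/c²) ₄F₃(3/2, 3/2, 1, 1; 2, 2, 2; 16/c²); that is, log(1 − u²) + ∫_{[0,2π)²} log(1 − u(cos θ₁ + cos θ₂) + u²) dΘ^{(2)}_unif = log(1 − u⁴) − (2/c²) Σ_{n=0}^{∞} ((3/2)_n)² n!/((n+1)!)³ · (16/c²)^n. -/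
open Real MeasureTheory

/-- A sum over `0, …, 2m` of a function vanishing at odd arguments is a sum over even arguments. -/
lemma sum_range_two_mul_add_one_of_odd_eq_zero {M : Type*} [AddCommMonoid M] (f : ℕ → M)
    (hf : ∀ j, f (2 * j + 1) = 0) (m : ℕ) :
    ∑ i ∈ Finset.range (2 * m + 1), f i = ∑ j ∈ Finset.range (m + 1), f (2 * j) := by
  induction m with
  | zero => simp
  | succ m ih =>
    rw [Finset.sum_range_succ _ (m + 1), ← ih, show 2 * (m + 1) + 1 = 2 * m + 1 + 1 + 1 by ring,
      Finset.sum_range_succ, Finset.sum_range_succ, hf, add_zero]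
    rfl

lemma choose_two_mul_mul_centralBinom_mul_centralBinom {m j : ℕ} (hj : j ≤ m) :
    (2 * m).choose (2 * j) * j.centralBinom * (m - j).centralBinom
      = m.centralBinom * m.choose j ^ 2 := by
  obtain ⟨l, rfl⟩ := Nat.exists_eq_add_of_le hj
  rw [Nat.add_sub_cancel_left]
  have h (n : ℕ) : (n.centralBinom : ℚ) = (2 * n).factorial / (n.factorial * n.factorial) := by
    rw [Nat.centralBinom, two_mul, Nat.cast_add_choose]
  have key : (((2 * (j + l)).choose (2 * j) : ℕ) : ℚ) * j.centralBinom * l.centralBinom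
      = (j + l).centralBinom * ((j + l).choose j : ℕ) ^ 2 := by
    have hjl : (((2 * (j + l)).choose (2 * j) : ℕ) : ℚ)
        = (2 * (j + l)).factorial / ((2 * j).factorial * (2 * l).factorial) := by
      rw [mul_add, Nat.cast_add_choose]
    rw [hjl, h, h, h, Nat.cast_add_choose]
    have h1 : ((2 * j).factorial : ℚ) ≠ 0 := by positivity
    have h2 : ((2 * l).factorial : ℚ) ≠ 0 := by positivity
    have h3 : (j.factorial : ℚ) ≠ 0 := by positivity
    have h4 : (l.factorial : ℚ) ≠ 0 := by positivity
    have h5 : ((j + l).factorial : ℚ) ≠ 0 := by positivity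
    field_simp
  exact_mod_cast key

lemma integral_cos_pow_add_two (n : ℕ) :
    ∫ x in (0 : ℝ)..2 * π, cos x ^ (n + 2)
      = (n + 1) / (n + 2) * ∫ x in (0 : ℝ)..2 * π, cos x ^ n := by
  rw [integral_cos_pow]
  simp

lemma integral_cos_pow_odd_eq_zero (j : ℕ) :
    ∫ x in (0 : ℝ)..2 * π, cos x ^ (2 * j + 1) = 0 := by
  induction j with
  | zero => simp
  | succ j ih =>
    rw [show 2 * (j + 1) + 1 = 2 * j + 1 + 2 by ring, integral_cos_pow_add_two, ih, mul_zero]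

lemma integral_cos_pow_even_eq_centralBinom (j : ℕ) :
    ∫ x in (0 : ℝ)..2 * π, cos x ^ (2 * j) = 2 * π * j.centralBinom / 4 ^ j := by
  induction j with
  | zero => simp
  | succ j ih =>
    rw [show 2 * (j + 1) = 2 * j + 2 by ring, integral_cos_pow_add_two, ih]
    have h : ((j : ℝ) + 1) * (j + 1).centralBinom = 2 * (2 * j + 1) * j.centralBinom :=
      mod_cast Nat.succ_mul_centralBinom_succ j
    have h' : ((j + 1).centralBinom : ℝ) = 2 * (2 * j + 1) * j.centralBinom / (j + 1) := by
      rw [eq_div_iff (by positivity), ← h]; ring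
    rw [h', pow_succ]
    push_cast
    field_simp
    ring

/-- The moments of `cos θ₀ + cos θ₁` in terms of those of `cos`. -/
lemma integral_cos_add_cos_pow_eq_sum (k : ℕ) :
    ∫ θ : Fin 2 → ℝ in Set.univ.pi fun _ => Set.Ico (0 : ℝ) (2 * π), (cos (θ 0) + cos (θ 1)) ^ k
      = ∑ i ∈ Finset.range (k + 1), (∫ x in (0 : ℝ)..2 * π, cos x ^ i)
          * (∫ x in (0 : ℝ)..2 * π, cos x ^ (k - i)) * k.choose i := by
  have hI (i : ℕ) : ∫ x in (0 : ℝ)..2 * π, cos x ^ i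
      = ∫ x in Set.Ico (0 : ℝ) (2 * π), cos x ^ i := by
    rw [intervalIntegral.integral_of_le (by positivity), integral_Ico_eq_integral_Ioc]
  simp_rw [add_pow]
  rw [volume_pi, Measure.restrict_pi_pi, integral_finsetSum]
  · refine Finset.sum_congr rfl fun i _ => ?_
    rw [integral_mul_const, hI, hI]
    congr 1
    have := integral_fintype_prod_eq_prod (𝕜 := ℝ)
      (μ := fun _ : Fin 2 => volume.restrict (Set.Ico (0 : ℝ) (2 * π)))
      (fun (l : Fin 2) (x : ℝ) => cos x ^ (![i, k - i] l))
    simpa [Fin.prod_univ_two] using this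
  · intro i _
    refine Integrable.of_bound (C := k.choose i) (Continuous.aestronglyMeasurable (by fun_prop))
      (Filter.Eventually.of_forall fun θ => ?_)
    rw [norm_mul, norm_mul, norm_pow, norm_pow]
    have h0 := pow_le_one₀ (n := i) (norm_nonneg (cos (θ 0))) (abs_cos_le_one (θ 0))
    have h1 := pow_le_one₀ (n := k - i) (norm_nonneg (cos (θ 1))) (abs_cos_le_one (θ 1))
    rw [Real.norm_natCast]
    exact mul_le_of_le_one_left (by positivity) (mul_le_one₀ h0 (by positivity) h1)

lemma integral_cos_add_cos_pow_odd (m : ℕ) :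
    ∫ θ : Fin 2 → ℝ in Set.univ.pi fun _ => Set.Ico (0 : ℝ) (2 * π),
      (cos (θ 0) + cos (θ 1)) ^ (2 * m + 1) = 0 := by
  rw [integral_cos_add_cos_pow_eq_sum]
  refine Finset.sum_eq_zero fun i hi => ?_
  rw [Finset.mem_range] at hi
  rcases Nat.even_or_odd' i with ⟨j, rfl | rfl⟩
  · rw [show 2 * m + 1 - 2 * j = 2 * (m - j) + 1 by lia, integral_cos_pow_odd_eq_zero]
    simp
  · rw [integral_cos_pow_odd_eq_zero]
    simp

lemma integral_cos_add_cos_pow_even (m : ℕ) :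
    ∫ θ : Fin 2 → ℝ in Set.univ.pi fun _ => Set.Ico (0 : ℝ) (2 * π),
      (cos (θ 0) + cos (θ 1)) ^ (2 * m) = (2 * π) ^ 2 * m.centralBinom ^ 2 / 4 ^ m := by
  rw [integral_cos_add_cos_pow_eq_sum, sum_range_two_mul_add_one_of_odd_eq_zero]
  · have hsum : (m.centralBinom : ℝ) = ∑ j ∈ Finset.range (m + 1), (m.choose j : ℝ) ^ 2 := by
      rw [Nat.centralBinom, ← Nat.sum_range_choose_sq]
      push_cast
      rfl
    rw [sq (m.centralBinom : ℝ)]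
    nth_rw 2 [hsum]
    rw [Finset.mul_sum, Finset.mul_sum, Finset.sum_div]
    refine Finset.sum_congr rfl fun j hj => ?_
    have hjm : j ≤ m := by rw [Finset.mem_range] at hj; lia
    have h : ((2 * m).choose (2 * j) : ℝ) * j.centralBinom * (m - j).centralBinom
        = m.centralBinom * m.choose j ^ 2 :=
      mod_cast choose_two_mul_mul_centralBinom_mul_centralBinom hjm
    have hpow : (4 : ℝ) ^ m = 4 ^ j * 4 ^ (m - j) := by
      rw [← pow_add, Nat.add_sub_cancel' hjm]
    rw [← Nat.mul_sub, integral_cos_pow_even_eq_centralBinom,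
      integral_cos_pow_even_eq_centralBinom, ← h, hpow]
    field_simp
  · intro j
    rw [integral_cos_pow_odd_eq_zero]
    simp

lemma abs_mul_cos_add_cos_le (t x y : ℝ) : |t * (cos x + cos y)| ≤ 2 * |t| := by
  rw [abs_mul, mul_comm]
  have h := abs_add_le (cos x) (cos y)
  have hx := abs_cos_le_one x
  have hy := abs_cos_le_one y
  exact mul_le_mul_of_nonneg_right (by linarith) (abs_nonneg t)

lemma continuous_log_one_sub_mul_cos_add_cos {t : ℝ} (ht : |t| < 1 / 2) :
    Continuous fun θ : Fin 2 → ℝ => log (1 - t * (cos (θ 0) + cos (θ 1))) := by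
  refine Continuous.log (by fun_prop) fun θ => ?_
  have h := (le_abs_self _).trans (abs_mul_cos_add_cos_le t (θ 0) (θ 1))
  exact ne_of_gt (by linarith)

lemma hasSum_integral_log_one_sub_mul_cos_add_cos {t : ℝ} (ht : |t| < 1 / 2) :
    HasSum (fun n : ℕ => t ^ (2 * (n + 1)) * (2 * π) ^ 2 * (n + 1).centralBinom ^ 2
        / (4 ^ (n + 1) * (2 * (n + 1))))
      (-∫ θ : Fin 2 → ℝ in Set.univ.pi fun _ => Set.Ico (0 : ℝ) (2 * π),
        log (1 - t * (cos (θ 0) + cos (θ 1)))) := by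
  have : IsFiniteMeasure ((volume : Measure (Fin 2 → ℝ)).restrict
      (Set.univ.pi fun _ => Set.Ico (0 : ℝ) (2 * π))) := by
    rw [volume_pi, Measure.restrict_pi_pi]
    infer_instance
  have hbd (θ : Fin 2 → ℝ) := abs_mul_cos_add_cos_le t (θ 0) (θ 1)
  have hsum : Summable fun n : ℕ => (2 * |t|) ^ (n + 1) :=
    (summable_nat_add_iff 1).2 (summable_geometric_of_lt_one (by positivity) (by linarith))
  have key := hasSum_integral_of_dominated_convergence
    (μ := (volume : Measure (Fin 2 → ℝ)).restrict (Set.univ.pi fun _ => Set.Ico (0 : ℝ) (2 * π)))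
    (F := fun (n : ℕ) θ => (t * (cos (θ 0) + cos (θ 1))) ^ (n + 1) / (n + 1))
    (f := fun θ => -log (1 - t * (cos (θ 0) + cos (θ 1))))
    (fun n _ => (2 * |t|) ^ (n + 1))
    (fun n => Continuous.aestronglyMeasurable (by fun_prop))
    (fun n => Filter.Eventually.of_forall fun θ => by
      rw [norm_div, norm_pow, Real.norm_eq_abs, Real.norm_of_nonneg (by positivity)]
      exact (div_le_self (by positivity) (by simp)).trans
        (pow_le_pow_left₀ (abs_nonneg _) (hbd θ) _))
    (Filter.Eventually.of_forall fun _ => hsum)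
    (integrable_const _)
    (Filter.Eventually.of_forall fun θ =>
      hasSum_pow_div_log_of_abs_lt_one ((hbd θ).trans_lt (by linarith)))
  rw [integral_neg] at key
  have hinj : Function.Injective fun n : ℕ => 2 * n + 1 := fun a b h => by
    simp only at h
    lia
  simp_rw [mul_pow, mul_div_right_comm, integral_const_mul] at key
  rw [← hinj.hasSum_iff] at key
  · convert! key using 2 with n
    simp only [Function.comp_apply]
    rw [show 2 * n + 1 + 1 = 2 * (n + 1) by ring, integral_cos_add_cos_pow_even]
    push_cast
    field_simp
    ring
  · intro n hn
    rcases Nat.even_or_odd' n with ⟨j, rfl | rfl⟩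
    · rw [integral_cos_add_cos_pow_odd, mul_zero]
    · exact absurd ⟨j, rfl⟩ hn

/-- The rising factorial `(3/2)_n` in terms of central binomial coefficients. -/
lemma ascPochhammer_eval_three_halves (n : ℕ) :
    (ascPochhammer ℝ n).eval (3 / 2)
      = 2 * (n + 1).factorial * (n + 1).centralBinom / 4 ^ (n + 1) := by
  induction n with
  | zero => simp [Nat.centralBinom]; norm_num [Nat.choose]
  | succ n ih =>
    have h : ((n : ℝ) + 1 + 1) * (n + 1 + 1).centralBinom
        = 2 * (2 * (n + 1) + 1) * (n + 1).centralBinom :=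
      mod_cast Nat.succ_mul_centralBinom_succ (n + 1)
    rw [ascPochhammer_succ_eval, ih, Nat.factorial_succ (n + 1), pow_succ _ (n + 1)]
    push_cast
    field_simp
    linear_combination (-2 : ℝ) * h

theorem stmt_13 (u : ℝ) (hu : u ∈ Set.Ioo (-1 : ℝ) 0) (c : ℝ) (hc : c = -2 * (u + u⁻¹)) :
    Real.log (1 - u ^ 2)
      + (1 / (2 * π) ^ 2) * (∫ θ : Fin 2 → ℝ in Set.univ.pi fun _ => Set.Ico (0:ℝ) (2 * π),
          Real.log (1 - u * (Real.cos (θ 0) + Real.cos (θ 1)) + u ^ 2))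
      = Real.log (1 - u ^ 4) - (2 / c ^ 2) * ∑' n : ℕ,
          ((ascPochhammer ℝ n).eval ((3:ℝ) / 2)) ^ 2 * (n.factorial : ℝ)
            / ((n + 1).factorial : ℝ) ^ 3 * (16 / c ^ 2) ^ n := by
  obtain ⟨hu1, hu0⟩ := hu
  have hu2 : 0 < 1 + u ^ 2 := by positivity
  set t : ℝ := u / (1 + u ^ 2) with ht_def
  have ht0 : t < 0 := div_neg_of_neg_of_pos hu0 hu2
  have ht : |t| < 1 / 2 := by
    rw [abs_of_neg ht0, ht_def, ← neg_div, div_lt_div_iff₀ hu2 two_pos]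
    nlinarith [sq_pos_of_pos (show 0 < 1 + u by linarith)]
  have hct : c = -2 / t := by
    have := hu0.ne
    rw [hc, ht_def]
    field_simp
    ring
  have hlog (θ : Fin 2 → ℝ) : log (1 - u * (cos (θ 0) + cos (θ 1)) + u ^ 2)
      = log (1 + u ^ 2) + log (1 - t * (cos (θ 0) + cos (θ 1))) := by
    have h := (le_abs_self _).trans (abs_mul_cos_add_cos_le t (θ 0) (θ 1))
    rw [← log_mul hu2.ne' (ne_of_gt (by linarith)), ht_def]
    congr 1
    field_simp
    ring
  have hint : IntegrableOn (fun θ : Fin 2 → ℝ => log (1 - t * (cos (θ 0) + cos (θ 1))))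
      (Set.univ.pi fun _ => Set.Ico (0 : ℝ) (2 * π)) :=
    ((continuous_log_one_sub_mul_cos_add_cos ht).continuousOn.integrableOn_compact
      (isCompact_univ_pi fun _ => isCompact_Icc)).mono_set
      (Set.pi_mono fun _ _ => Set.Ico_subset_Icc_self)
  have hvol : (volume : Measure (Fin 2 → ℝ)).real
      (Set.univ.pi fun _ => Set.Ico (0 : ℝ) (2 * π)) = (2 * π) ^ 2 := by
    rw [Measure.real, volume_pi, Measure.pi_pi]
    simp [ENNReal.toReal_mul, pi_pos.le]
  have hser := hasSum_integral_log_one_sub_mul_cos_add_cos ht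
  have hterm (n : ℕ) : ((ascPochhammer ℝ n).eval ((3:ℝ) / 2)) ^ 2 * (n.factorial : ℝ)
      / ((n + 1).factorial : ℝ) ^ 3 * (16 / c ^ 2) ^ n
      = c ^ 2 / (2 * (2 * π) ^ 2) * (t ^ (2 * (n + 1)) * (2 * π) ^ 2 * (n + 1).centralBinom ^ 2
        / (4 ^ (n + 1) * (2 * (n + 1)))) := by
    have h16 : 16 / c ^ 2 = 4 * t ^ 2 := by
      rw [hct]
      have := ht0.ne
      field_simp
      norm_num
    have hc2 : c ^ 2 = 4 / t ^ 2 := by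
      rw [hct, div_pow]
      norm_num
    rw [h16, hc2, ascPochhammer_eval_three_halves, Nat.factorial_succ, mul_pow, ← pow_mul]
    have := ht0.ne
    have := n.factorial_ne_zero
    push_cast
    field_simp
    ring
  have hc0 : c ≠ 0 := by
    rw [hct]
    exact div_ne_zero (by norm_num) ht0.ne
  have hvolume_ne : volume (Set.univ.pi fun _ : Fin 2 => Set.Ico (0 : ℝ) (2 * π)) ≠ ⊤ := by
    rw [volume_pi, Measure.pi_pi]
    exact ENNReal.prod_ne_top fun _ _ => by rw [Real.volume_Ico]; exact ENNReal.ofReal_ne_top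
  have hconst : IntegrableOn (fun _ : Fin 2 → ℝ => log (1 + u ^ 2))
      (Set.univ.pi fun _ => Set.Ico (0 : ℝ) (2 * π)) :=
    integrableOn_const hvolume_ne
  simp_rw [hlog, hterm]
  rw [integral_add hconst hint, setIntegral_const, hvol, tsum_mul_left,
    hser.tsum_eq, show 1 - u ^ 4 = (1 - u ^ 2) * (1 + u ^ 2) by ring,
    log_mul (by nlinarith) hu2.ne', smul_eq_mul]
  have := pi_pos.ne'
  field_simp
  ring
end

section
/- The spanning tree constant of ℤ² satisfies λ_{ℤ²} = ℒ(A_RW, T²_∞, 1) + log 4 = 4G/π; that is, ∫_{[0,2π)²} log(4 − 2 cos θ₁ − 2 cos θ₂) dΘ^{(2)}_unif = (4/π) · Σ_{n=0}^{∞} (−1)ⁿ/(2n+1)². -/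
open Real MeasureTheory

open Set intervalIntegral

theorem cos_lt_one_of_mem_Ioc_of_ne {x : ℝ} (hx : x ∈ Ioc 0 (2 * π)) (hne : x ≠ 2 * π) :
    cos x < 1 := by
  refine lt_of_le_of_ne (cos_le_one x) fun h => ?_
  rw [cos_eq_one_iff_of_lt_of_lt (by linarith [hx.1, pi_pos]) (lt_of_le_of_ne hx.2 hne)] at h
  linarith [hx.1]

theorem norm_circleMap_sub_ofReal_sq (θ r : ℝ) :
    ‖circleMap 0 1 θ - (r : ℂ)‖ ^ 2 = 1 - 2 * r * cos θ + r ^ 2 := by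
  rw [← Complex.normSq_eq_norm_sq, Complex.normSq_apply]
  have hre : (circleMap 0 1 θ).re = cos θ := by simp [circleMap, Complex.exp_ofReal_mul_I_re]
  have him : (circleMap 0 1 θ).im = sin θ := by simp [circleMap, Complex.exp_ofReal_mul_I_im]
  simp only [Complex.sub_re, Complex.sub_im, hre, him, Complex.ofReal_re, Complex.ofReal_im]
  linear_combination sin_sq_add_cos_sq θ

/-- Jensen's formula for `exp y - z` on the unit circle, written as a real integral. -/
theorem integral_log_two_mul_cosh_sub_two_mul_cos {y : ℝ} (hy : 0 ≤ y) :
    ∫ θ in 0..2 * π, log (2 * cosh y - 2 * cos θ) = 2 * π * y := by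
  have hcirc := circleAverage_log_norm_sub_const_eq_posLog (a := (rexp y : ℂ))
  have hint : IntervalIntegrable (fun θ => log ‖circleMap 0 1 θ - (rexp y : ℂ)‖) volume
      0 (2 * π) := circleIntegrable_log_norm_sub_const (a := (rexp y : ℂ)) (c := 0) 1
  rw [circleAverage_def, smul_eq_mul] at hcirc
  have hlog : log⁺ ‖(rexp y : ℂ)‖ = y := by
    rw [Complex.norm_real, norm_of_nonneg (exp_pos y).le, posLog_eq_log, log_exp]
    rw [abs_of_pos (exp_pos y)]
    exact one_le_exp hy
  rw [hlog, inv_mul_eq_iff_eq_mul₀ (by positivity)] at hcirc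
  have hnorm (θ : ℝ) : ‖circleMap 0 1 θ - (rexp y : ℂ)‖ ^ 2
      = rexp y * (2 * cosh y - 2 * cos θ) := by
    rw [norm_circleMap_sub_ofReal_sq, cosh_eq, exp_neg]
    have := exp_pos y
    field_simp
    ring
  have hae : ∀ᵐ θ : ℝ, θ ∈ uIoc 0 (2 * π) → log (2 * cosh y - 2 * cos θ)
      = 2 * log ‖circleMap 0 1 θ - (rexp y : ℂ)‖ - y := by
    have hne : ∀ᵐ θ : ℝ, θ ≠ 2 * π := Measure.ae_ne volume (2 * π)
    filter_upwards [hne] with θ hθ hmem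
    rw [uIoc_of_le (by positivity)] at hmem
    have hcos := cos_lt_one_of_mem_Ioc_of_ne hmem hθ
    have hpos : 0 < 2 * cosh y - 2 * cos θ := by linarith [one_le_cosh y]
    have h := congrArg log (hnorm θ)
    rw [log_pow, log_mul (exp_pos y).ne' hpos.ne', log_exp] at h
    rw [Nat.cast_ofNat] at h
    linarith
  rw [integral_congr_ae hae, integral_sub (hint.const_mul 2) intervalIntegrable_const,
    intervalIntegral.integral_const_mul, hcirc]
  simp
  ring

theorem integral_log_four_sub_cos_sub_cos {x : ℝ} (hx : x ∈ Icc 0 (2 * π)) :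
    ∫ θ in 0..2 * π, log (4 - 2 * cos x - 2 * cos θ) = 4 * π * arsinh (sin (x / 2)) := by
  have hs : 0 ≤ arsinh (sin (x / 2)) :=
    arsinh_nonneg_iff.2 (sin_nonneg_of_nonneg_of_le_pi (by linarith [hx.1]) (by linarith [hx.2]))
  have h := integral_log_two_mul_cosh_sub_two_mul_cos (y := 2 * arsinh (sin (x / 2)))
    (by positivity)
  have hc : 2 * cosh (2 * arsinh (sin (x / 2))) = 4 - 2 * cos x := by
    rw [cosh_two_mul, cosh_sq, sinh_arsinh]
    have : cos x = 1 - 2 * sin (x / 2) ^ 2 := by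
      rw [← cos_sq_add_sin_sq (x / 2)]
      conv_lhs => rw [← mul_div_cancel₀ x (two_ne_zero' ℝ), cos_two_mul']
      ring
    rw [this]; ring
  rw [hc] at h
  rw [h]; ring

theorem integrableOn_log_four_sub_cos_sub_cos :
    IntegrableOn (fun p : ℝ × ℝ => log (4 - 2 * cos p.1 - 2 * cos p.2))
      (Ioc 0 (2 * π) ×ˢ Ioc 0 (2 * π)) := by
  have h1 : IntervalIntegrable (fun θ => log ‖circleMap 0 1 θ - 1‖) volume 0 (2 * π) :=
    circleIntegrable_log_norm_sub_const (a := 1) (c := 0) 1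
  have hnorm (θ : ℝ) : 2 * log ‖circleMap 0 1 θ - 1‖ = log (2 - 2 * cos θ) := by
    have h2 : ‖circleMap 0 1 θ - 1‖ ^ 2 = 2 - 2 * cos θ := by
      have := norm_circleMap_sub_ofReal_sq θ 1
      rw [Complex.ofReal_one] at this
      linarith
    rw [← h2, log_pow]; norm_num
  have h3 : IntegrableOn (fun θ => log (2 - 2 * cos θ)) (Ioc 0 (2 * π)) := by
    rw [← intervalIntegrable_iff_integrableOn_Ioc_of_le (by positivity)]
    simpa only [hnorm] using h1.const_mul 2
  have h4 : IntegrableOn (fun p : ℝ × ℝ => log 8 + |log (2 - 2 * cos p.1)|)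
      (Ioc 0 (2 * π) ×ˢ Ioc 0 (2 * π)) := by
    rw [IntegrableOn, Measure.volume_eq_prod, ← Measure.prod_restrict]
    exact (integrable_const _).add (h3.abs.comp_fst _)
  refine h4.mono' (Measurable.aestronglyMeasurable (by fun_prop)) ?_
  have hne : ∀ᵐ p : ℝ × ℝ, p.1 ≠ 2 * π := by
    rw [Measure.volume_eq_prod]
    exact Measure.quasiMeasurePreserving_fst.ae (Measure.ae_ne volume (2 * π))
  filter_upwards [ae_restrict_of_ae hne,
    ae_restrict_mem (measurableSet_Ioc.prod measurableSet_Ioc)] with p hp hmem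
  have hcos := cos_lt_one_of_mem_Ioc_of_ne hmem.1 hp
  have hlow : log (2 - 2 * cos p.1) ≤ log (4 - 2 * cos p.1 - 2 * cos p.2) :=
    log_le_log (by linarith) (by linarith [cos_le_one p.2])
  have hup : log (4 - 2 * cos p.1 - 2 * cos p.2) ≤ log 8 :=
    log_le_log (by linarith [cos_le_one p.2]) (by linarith [neg_one_le_cos p.1, neg_one_le_cos p.2])
  have h8 : 0 ≤ log (8 : ℝ) := log_nonneg (by norm_num)
  rw [norm_eq_abs, abs_le]
  constructor
  · linarith [neg_abs_le (log (2 - 2 * cos p.1))]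
  · linarith [abs_nonneg (log (2 - 2 * cos p.1))]

theorem integral_sin_div_sqrt {t : ℝ} (ht : t ≠ 0) :
    ∫ u in 0..π / 2, sin u / √(1 + (t * sin u) ^ 2) = arctan t / t := by
  have hD : 0 < 1 + t ^ 2 := by positivity
  have hs : 0 < √(1 + t ^ 2) := sqrt_pos.2 hD
  set k := t / √(1 + t ^ 2) with hk
  have hk2 : k ^ 2 = t ^ 2 / (1 + t ^ 2) := by rw [hk, div_pow, sq_sqrt hD.le]
  have hk1 : k ^ 2 < 1 := by rw [hk2, div_lt_one hD]; linarith
  have hder (u : ℝ) : HasDerivAt (fun u => -arcsin (k * cos u) / t)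
      (sin u / √(1 + (t * sin u) ^ 2)) u := by
    have hlt : (k * cos u) ^ 2 < 1 := by
      rw [mul_pow]
      nlinarith [cos_sq_le_one u, sq_nonneg k, sq_nonneg (cos u)]
    have h1 : k * cos u ≠ -1 := fun h => by rw [h] at hlt; norm_num at hlt
    have h2 : k * cos u ≠ 1 := fun h => by rw [h] at hlt; norm_num at hlt
    have h := (((hasDerivAt_arcsin h1 h2).comp u ((hasDerivAt_cos u).const_mul k)).neg).div_const t
    refine h.congr_deriv ?_
    have hsq : 1 - (k * cos u) ^ 2 = (1 + (t * sin u) ^ 2) / (1 + t ^ 2) := by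
      rw [mul_pow, hk2, cos_sq']
      field_simp
      ring
    have hpos : 0 < √(1 + (t * sin u) ^ 2) := sqrt_pos.2 (by positivity)
    rw [hsq, sqrt_div (by positivity), hk]
    field_simp
  rw [integral_eq_sub_of_hasDerivAt (fun u _ => hder u)]
  · simp [arctan_eq_arcsin, hk]
    ring
  · refine Continuous.intervalIntegrable ?_ _ _
    exact continuous_sin.div (by fun_prop) fun u => (sqrt_pos.2 (by positivity)).ne'

theorem arsinh_eq_integral (s : ℝ) : arsinh s = ∫ t in 0..1, s / √(1 + (t * s) ^ 2) := by
  have hder (t : ℝ) : HasDerivAt (fun t => arsinh (t * s)) (s / √(1 + (t * s) ^ 2)) t := by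
    refine ((hasDerivAt_id t).mul_const s).arsinh.congr_deriv ?_
    simp [div_eq_inv_mul]
  rw [integral_eq_sub_of_hasDerivAt (fun t _ => hder t)]
  · simp
  · refine Continuous.intervalIntegrable ?_ _ _
    exact continuous_const.div (by fun_prop) fun u => (sqrt_pos.2 (by positivity)).ne'

theorem integral_arsinh_sin :
    ∫ u in 0..π / 2, arsinh (sin u) = ∫ t in 0..1, arctan t / t := by
  simp_rw [fun u => arsinh_eq_integral (sin u)]
  rw [intervalIntegral_intervalIntegral_swap]
  · refine integral_congr_ae ?_
    filter_upwards [Measure.ae_ne volume (0 : ℝ)] with t ht _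
    exact integral_sin_div_sqrt ht
  · have hc : Continuous (Function.uncurry fun u t : ℝ => sin u / √(1 + (t * sin u) ^ 2)) :=
      (continuous_sin.comp continuous_fst).div (by fun_prop)
        fun p => (sqrt_pos.2 (by positivity)).ne'
    exact (hc.continuousOn.integrableOn_compact (isCompact_uIcc.prod isCompact_uIcc)).mono_set
      (prod_mono uIoc_subset_uIcc uIoc_subset_uIcc)

theorem integral_arctan_div_self :
    ∫ t in 0..1, arctan t / t = ∑' n : ℕ, (-1 : ℝ) ^ n / (2 * n + 1) ^ 2 := by
  have hpow (n : ℕ) : ∫ t in Ioo (0 : ℝ) 1, t ^ (2 * n) = 1 / (2 * n + 1) := by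
    rw [← integral_Ioc_eq_integral_Ioo, ← integral_of_le zero_le_one, integral_pow]
    simp
  have hsum : Summable fun n : ℕ => (1 : ℝ) / (2 * n + 1) ^ 2 := by
    have h := (Real.summable_one_div_nat_pow (p := 2)).2 one_lt_two
    have hinj : Function.Injective fun n : ℕ => 2 * n + 1 := fun a b hab => by
      simpa using hab
    simpa [Function.comp_def] using h.comp_injective hinj
  have key := hasSum_integral_of_summable_integral_norm (μ := volume.restrict (Ioo (0 : ℝ) 1))
    (F := fun (n : ℕ) t => (-1 : ℝ) ^ n / (2 * n + 1) * t ^ (2 * n)) ?_ ?_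
  · rw [integral_of_le zero_le_one, integral_Ioc_eq_integral_Ioo]
    trans ∫ t in Ioo (0 : ℝ) 1, ∑' n : ℕ, (-1 : ℝ) ^ n / (2 * n + 1) * t ^ (2 * n)
    · refine setIntegral_congr_fun measurableSet_Ioo fun t ht => ?_
      have h := (hasSum_arctan (x := t) (by
        rw [norm_eq_abs, abs_of_pos ht.1]; exact ht.2)).div_const t
      rw [← h.tsum_eq]
      refine tsum_congr fun n => ?_
      have := ht.1.ne'
      push_cast
      field_simp
      ring
    · rw [← key.tsum_eq]
      refine tsum_congr fun n => ?_
      rw [MeasureTheory.integral_const_mul, hpow]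
      field_simp
  · intro n
    exact (Continuous.integrableOn_Icc (a := 0) (b := 1) (by fun_prop)).mono_set Ioo_subset_Icc_self
  · refine hsum.congr fun n => ?_
    trans ∫ t in Ioo (0 : ℝ) 1, 1 / (2 * n + 1) * t ^ (2 * n)
    · rw [MeasureTheory.integral_const_mul, hpow]
      field_simp
    · refine setIntegral_congr_fun measurableSet_Ioo fun t ht => ?_
      have h1 : |(2 * n + 1 : ℝ)| = 2 * n + 1 := abs_of_pos (by positivity)
      simp [h1, abs_of_pos ht.1]

theorem integral_arsinh_sin_half :
    ∫ x in 0..2 * π, arsinh (sin (x / 2)) = 4 * ∫ u in 0..π / 2, arsinh (sin u) := by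
  have hint (a b : ℝ) : IntervalIntegrable (fun u => arsinh (sin u)) volume a b :=
    (continuous_sin.arsinh).intervalIntegrable a b
  have h1 : ∫ u in π / 2..π, arsinh (sin u) = ∫ u in 0..π / 2, arsinh (sin u) := by
    have h := integral_comp_sub_left (fun u => arsinh (sin u)) (a := 0) (b := π / 2) π
    simp only [sin_pi_sub, sub_zero] at h
    rw [h]
    congr 1
    ring
  rw [integral_comp_div (fun u => arsinh (sin u)) two_ne_zero, zero_div,
    mul_div_cancel_left₀ π two_ne_zero,
    ← integral_add_adjacent_intervals (hint 0 (π / 2)) (hint (π / 2) π), h1, smul_eq_mul]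
  ring

theorem stmt_18 :
    (1 / (2 * π) ^ 2) * (∫ θ : Fin 2 → ℝ in Set.univ.pi fun _ => Set.Ico (0:ℝ) (2 * π),
        Real.log (4 - 2 * Real.cos (θ 0) - 2 * Real.cos (θ 1)))
      = (4 / π) * ∑' n : ℕ, (-1 : ℝ) ^ n / (2 * n + 1) ^ 2 := by
  have hset : (Set.univ.pi fun _ : Fin 2 => Ico (0 : ℝ) (2 * π))
      =ᵐ[volume] Set.univ.pi fun _ : Fin 2 => Ioc (0 : ℝ) (2 * π) :=
    Measure.univ_pi_Ico_ae_eq_Icc.trans Measure.univ_pi_Ioc_ae_eq_Icc.symm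
  have hpre : (Set.univ.pi fun _ : Fin 2 => Ioc (0 : ℝ) (2 * π))
      = MeasurableEquiv.finTwoArrow ⁻¹' (Ioc (0 : ℝ) (2 * π) ×ˢ Ioc (0 : ℝ) (2 * π)) := by
    ext θ
    simp [MeasurableEquiv.finTwoArrow, Fin.forall_fin_two]
  have htransfer : ∫ θ : Fin 2 → ℝ in Set.univ.pi fun _ => Ico (0:ℝ) (2 * π),
        log (4 - 2 * cos (θ 0) - 2 * cos (θ 1))
      = ∫ p in Ioc (0 : ℝ) (2 * π) ×ˢ Ioc (0 : ℝ) (2 * π),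
        log (4 - 2 * cos p.1 - 2 * cos p.2) := by
    rw [setIntegral_congr_set hset, hpre]
    exact (volume_preserving_finTwoArrow ℝ).setIntegral_preimage_emb
      (MeasurableEquiv.measurableEmbedding _)
      (fun p : ℝ × ℝ => log (4 - 2 * cos p.1 - 2 * cos p.2)) _
  have hiter : ∫ p in Ioc (0 : ℝ) (2 * π) ×ˢ Ioc (0 : ℝ) (2 * π),
        log (4 - 2 * cos p.1 - 2 * cos p.2)
      = ∫ x in 0..2 * π, 4 * π * arsinh (sin (x / 2)) := by
    rw [Measure.volume_eq_prod, setIntegral_prod _ integrableOn_log_four_sub_cos_sub_cos,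
      integral_of_le (by positivity)]
    refine setIntegral_congr_fun measurableSet_Ioc fun x hx => ?_
    rw [← integral_log_four_sub_cos_sub_cos (Ioc_subset_Icc_self hx),
      integral_of_le (by positivity)]
  rw [htransfer, hiter, intervalIntegral.integral_const_mul, integral_arsinh_sin_half,
    integral_arsinh_sin, integral_arctan_div_self]
  field_simp
  ring
end
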